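/- Let N ≥ 1, let Ω ⊆ ℝ^N be an open set, and let u ∈ L^1(Ω) have a weak gradient g ∈ L^1(Ω; ℝ^N) with g ≠ 0 almost everywhere in Ω. Then for every constant c ∈ ℝ, the level set {x ∈ Ω : u(x) = c} has Lebesgue measure zero. -/

import Mathlib

open MeasureTheory Filter Topology RealInnerProductSpace

noncomputable section

/-- `φ` is a test function on `Ω`: smooth with compact support contained in `Ω`. -/
def IsTestFun (N : ℕ) (Ω : Set (EuclideanSpace ℝ (Fin N)))
    (φ : EuclideanSpace ℝ (Fin N) → ℝ) : Prop :=
  ContDiff ℝ (⊤ : ℕ∞) φ ∧ HasCompactSupport φ ∧ tsupport φ ⊆ Ω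

/-- `g ∈ L¹(Ω; ℝ^N)` is the weak gradient of `u ∈ L¹(Ω)`:
for every test function `φ` and every index `i`, `∫_Ω u ∂ᵢφ = -∫_Ω gᵢ φ`. -/
def IsWeakGradient (N : ℕ) (Ω : Set (EuclideanSpace ℝ (Fin N)))
    (u : EuclideanSpace ℝ (Fin N) → ℝ)
    (g : EuclideanSpace ℝ (Fin N) → EuclideanSpace ℝ (Fin N)) : Prop :=
  IntegrableOn u Ω volume ∧ IntegrableOn g Ω volume ∧
  ∀ φ : EuclideanSpace ℝ (Fin N) → ℝ, IsTestFun N Ω φ → ∀ i : Fin N,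
    ∫ x in Ω, u x * fderiv ℝ φ x (EuclideanSpace.single i 1) ∂volume
      = - ∫ x in Ω, g x i * φ x ∂volume

/-- `u ∈ W₀^{1,1}(Ω)` with weak gradient `g`: `g` is the weak gradient of `u`, and there is a
sequence of test functions converging to `u` in `L¹(Ω)` whose gradients converge to `g`
in `L¹(Ω; ℝ^N)`. -/
def MemW0_1_1 (N : ℕ) (Ω : Set (EuclideanSpace ℝ (Fin N)))
    (u : EuclideanSpace ℝ (Fin N) → ℝ)
    (g : EuclideanSpace ℝ (Fin N) → EuclideanSpace ℝ (Fin N)) : Prop :=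
  IsWeakGradient N Ω u g ∧
  ∃ φ : ℕ → EuclideanSpace ℝ (Fin N) → ℝ,
    (∀ n, IsTestFun N Ω (φ n)) ∧
    Tendsto (fun n => ∫ x in Ω, |φ n x - u x| ∂volume) atTop (𝓝 0) ∧
    Tendsto (fun n => ∫ x in Ω, ‖gradient (φ n) x - g x‖ ∂volume) atTop (𝓝 0)

open ContinuousLinearMap Convolution

theorem scheffe_aux {α : Type*} [MeasurableSpace α] {μ : Measure α} {f : ℕ → α → ℝ} {h : α → ℝ}
    (hf : ∀ n, Integrable (f n) μ) (hh : Integrable h μ) (hf0 : ∀ n x, 0 ≤ f n x)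
    (hlim : ∀ᵐ x ∂μ, Tendsto (fun n => f n x) atTop (𝓝 (h x)))
    (hint : ∀ n, ∫ x, f n x ∂μ = ∫ x, h x ∂μ) :
    Tendsto (fun n => ∫ x, |f n x - h x| ∂μ) atTop (𝓝 0) := by
  have e : ∀ n, ∫ x, |f n x - h x| ∂μ = 2 * ∫ x, max (h x - f n x) 0 ∂μ := by
    intro n
    have h1 : ∀ x, |f n x - h x| = 2 * max (h x - f n x) 0 - (h x - f n x) := by
      intro x
      rcases le_total (f n x) (h x) with h' | h'
      · rw [abs_of_nonpos (by linarith), max_eq_left (by linarith)]; ring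
      · rw [abs_of_nonneg (by linarith), max_eq_right (by linarith)]; ring
    simp_rw [h1]
    have i1 : Integrable (fun x => h x - f n x) μ := hh.sub (hf n)
    rw [integral_sub (i1.pos_part.const_mul 2) i1, integral_sub hh (hf n), hint n,
      integral_const_mul]
    ring
  simp_rw [e]
  have : Tendsto (fun n => ∫ x, max (h x - f n x) 0 ∂μ) atTop (𝓝 (∫ _x, (0:ℝ) ∂μ)) := by
    refine tendsto_integral_of_dominated_convergence (fun x => |h x|)
      (fun n => (hh.sub (hf n)).pos_part.aestronglyMeasurable) hh.abs ?_ ?_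
    · intro n
      filter_upwards with x
      rw [Real.norm_of_nonneg (le_max_right _ _)]
      refine max_le ?_ (abs_nonneg _)
      have := hf0 n x
      have := le_abs_self (h x)
      linarith
    · filter_upwards [hlim] with x hx
      have : Tendsto (fun n => max (h x - f n x) 0) atTop (𝓝 (max (h x - h x) 0)) :=
        (tendsto_const_nhds.sub hx).max tendsto_const_nhds
      simpa using this
  simpa using this.const_mul 2

variable {E : Type*} [NormedAddCommGroup E] [InnerProductSpace ℝ E] [FiniteDimensional ℝ E]
  [MeasurableSpace E] [BorelSpace E]

/-- mollification -/
def moll (ρ : ContDiffBump (0 : E)) (f : E → ℝ) : E → ℝ :=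
  (ρ.normed volume) ⋆[lsmul ℝ ℝ, volume] f

theorem moll_apply (ρ : ContDiffBump (0 : E)) (f : E → ℝ) (x : E) :
    moll ρ f x = ∫ t, ρ.normed volume (x - t) * f t := by
  rw [moll, convolution_eq_swap]; rfl

theorem moll_integrable (ρ : ContDiffBump (0 : E)) {f : E → ℝ} (hf : Integrable f) :
    Integrable (moll ρ f) := ρ.integrable_normed.integrable_convolution _ hf

theorem moll_integral (ρ : ContDiffBump (0 : E)) {f : E → ℝ} (hf : Integrable f) :
    ∫ x, moll ρ f x = ∫ x, f x := by
  rw [moll, integral_convolution (lsmul ℝ ℝ) (ρ.integrable_normed (μ := volume)) hf,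
    ρ.integral_normed]; simp

theorem moll_sub (ρ : ContDiffBump (0 : E)) {f h : E → ℝ} (hf : Integrable f) (hh : Integrable h)
    (x : E) : moll ρ (fun y => f y - h y) x = moll ρ f x - moll ρ h x := by
  have A : ∀ {k : E → ℝ}, Integrable k → Integrable (fun t => ρ.normed volume (x - t) * k t) := by
    intro k hk
    have := (ρ.hasCompactSupport_normed (μ := volume)).convolutionExists_left (μ := volume) (lsmul ℝ ℝ)
      ρ.continuous_normed hk.locallyIntegrable x
    simpa using this.integrable_swap
  simp_rw [moll_apply, mul_sub]
  rw [integral_sub (A hf) (A hh)]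

theorem moll_nonneg (ρ : ContDiffBump (0 : E)) {f : E → ℝ} (hf : ∀ x, 0 ≤ f x) (x : E) :
    0 ≤ moll ρ f x := by
  rw [moll_apply]
  exact integral_nonneg fun t => mul_nonneg (ρ.nonneg_normed _) (hf t)

theorem moll_contDiff (ρ : ContDiffBump (0 : E)) {f : E → ℝ} (hf : Integrable f) :
    ContDiff ℝ 1 (moll ρ f) :=
  ρ.hasCompactSupport_normed.contDiff_convolution_left _ (ρ.contDiff_normed (n := 1) (μ := volume))
    hf.locallyIntegrable

theorem moll_tendsto {ρ : ℕ → ContDiffBump (0 : E)}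
    (hρ : Tendsto (fun n => (ρ n).rOut) atTop (𝓝 0))
    (hρ' : ∀ n, (ρ n).rOut ≤ 2 * (ρ n).rIn) {f : E → ℝ} (hf : Integrable f) :
    ∀ᵐ x, Tendsto (fun n => moll (ρ n) f x) atTop (𝓝 (f x)) :=
  ContDiffBump.ae_convolution_tendsto_right_of_locallyIntegrable hρ
    (Eventually.of_forall hρ') hf.locallyIntegrable

theorem moll_tendsto_L1 {ρ : ℕ → ContDiffBump (0 : E)}
    (hρ : Tendsto (fun n => (ρ n).rOut) atTop (𝓝 0))
    (hρ' : ∀ n, (ρ n).rOut ≤ 2 * (ρ n).rIn) {f : E → ℝ} (hf : Integrable f) :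
    Tendsto (fun n => ∫ x, |moll (ρ n) f x - f x|) atTop (𝓝 0) := by
  have key : ∀ {k : E → ℝ}, Integrable k → (∀ x, 0 ≤ k x) →
      Tendsto (fun n => ∫ x, |moll (ρ n) k x - k x|) atTop (𝓝 0) := by
    intro k hk hk0
    exact scheffe_aux (fun n => moll_integrable _ hk) hk (fun n x => moll_nonneg _ hk0 x)
      (moll_tendsto hρ hρ' hk) (fun n => moll_integral _ hk)
  have ip := hf.pos_part
  have im := hf.neg_part
  have hp := key ip (fun x => le_max_right _ _)
  have hm := key im (fun x => le_max_right _ _)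
  have hsum := hp.add hm
  rw [add_zero] at hsum
  have hdec : f = fun x => max (f x) 0 - max (-f x) 0 := by
    funext x
    rcases le_total 0 (f x) with h | h
    · rw [max_eq_left h, max_eq_right (by linarith)]; ring
    · rw [max_eq_right h, max_eq_left (by linarith)]; ring
  refine squeeze_zero (fun n => integral_nonneg fun x => abs_nonneg _) (fun n => ?_) hsum
  refine le_of_le_of_eq ?_ (integral_add ((moll_integrable (ρ n) ip).sub ip).abs
    ((moll_integrable (ρ n) im).sub im).abs)
  refine integral_mono ((moll_integrable _ hf).sub hf).abs
    (((moll_integrable _ ip).sub ip).abs.add ((moll_integrable _ im).sub im).abs) fun x => ?_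
  have e1 : moll (ρ n) f x = moll (ρ n) (fun x => max (f x) 0) x
      - moll (ρ n) (fun x => max (-f x) 0) x := by
    rw [← moll_sub _ ip im, ← hdec]
  have e2 : f x = max (f x) 0 - max (-f x) 0 := congrFun hdec x
  have := abs_sub (moll (ρ n) (fun x => max (f x) 0) x - max (f x) 0)
    (moll (ρ n) (fun x => max (-f x) 0) x - max (-f x) 0)
  refine le_trans (le_of_eq ?_) this
  congr 1; linarith

theorem moll_fderiv (ρ : ContDiffBump (0 : E)) {f : E → ℝ} (hf : Integrable f) (x e : E) :
    fderiv ℝ (moll ρ f) x e = - ∫ t, f t * fderiv ℝ (fun y => ρ.normed volume (x - y)) t e := by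
  have hd := by
    have := ρ.hasCompactSupport_normed.hasFDerivAt_convolution_right (lsmul ℝ ℝ).flip
      hf.locallyIntegrable (ρ.contDiff_normed (n := 1) (μ := volume)) x
    rw [convolution_flip] at this
    exact this
  rw [moll, hd.fderiv, convolution_precompR_apply _ hf.locallyIntegrable
    (ρ.hasCompactSupport_normed.fderiv ℝ)
    ((ρ.contDiff_normed (n := 1)).continuous_fderiv (by norm_num)), convolution_def,
    ← integral_neg]
  congr 1
  funext t
  have h1 : HasFDerivAt (fun y => ρ.normed volume (x - y))
      ((fderiv ℝ (ρ.normed volume) (x - t)).comp (-ContinuousLinearMap.id ℝ E)) t := by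
    refine HasFDerivAt.comp (g := ρ.normed volume) t
      (((ρ.contDiff_normed (n := 1)).differentiable (by norm_num) _).hasFDerivAt) ?_
    exact (hasFDerivAt_id t).const_sub x
  rw [h1.fderiv]
  simp [mul_comm]

theorem chain_rule (N : ℕ) (Ω : Set (EuclideanSpace ℝ (Fin N))) (hΩ : IsOpen Ω)
    (u : EuclideanSpace ℝ (Fin N) → ℝ)
    (g : EuclideanSpace ℝ (Fin N) → EuclideanSpace ℝ (Fin N))
    (hu : IsWeakGradient N Ω u g) (F F' : ℝ → ℝ) (hF : ∀ t, HasDerivAt F (F' t) t)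
    (hF' : Continuous F') {M : ℝ} (hM : ∀ t, |F t| ≤ M) (hM' : ∀ t, |F' t| ≤ 1)
    (φ : EuclideanSpace ℝ (Fin N) → ℝ) (hφ : IsTestFun N Ω φ) (i : Fin N) :
    ∫ x, F (Ω.indicator u x) * fderiv ℝ φ x (EuclideanSpace.single i 1)
      = - ∫ x, F' (Ω.indicator u x) * Ω.indicator (fun x => g x i) x * φ x := by
  obtain ⟨hui, hgi, hw⟩ := hu
  obtain ⟨hφs, hφc, hφΩ⟩ := hφ
  set e : EuclideanSpace ℝ (Fin N) := EuclideanSpace.single i 1 with he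
  set U := Ω.indicator u with hU
  set G := Ω.indicator (fun x => g x i) with hG
  have iU : Integrable U := hui.integrable_indicator hΩ.measurableSet
  have iG : Integrable G := by
    refine IntegrableOn.integrable_indicator ?_ hΩ.measurableSet
    exact (EuclideanSpace.proj (𝕜 := ℝ) i).integrable_comp hgi
  have Fc : Continuous F := continuous_iff_continuousAt.2 fun t => (hF t).continuousAt
  have hφ1 : ContDiff ℝ 1 φ := hφs.of_le (by exact_mod_cast le_top)
  have hφd : Continuous fun x => fderiv ℝ φ x e :=
    (hφ1.continuous_fderiv (by norm_num)).clm_apply continuous_const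
  have hφdc : HasCompactSupport fun x => fderiv ℝ φ x e := hφc.fderiv_apply ℝ e
  obtain ⟨δ, hδ, hδΩ⟩ := hφc.isCompact.exists_cthickening_subset_open hΩ hφΩ
  let ρ : ℕ → ContDiffBump (0 : EuclideanSpace ℝ (Fin N)) := fun n =>
    { rIn := δ / (n + 1) / 2
      rOut := δ / (n + 1)
      rIn_pos := by positivity
      rIn_lt_rOut := half_lt_self (by positivity) }
  have hρ : Tendsto (fun n => (ρ n).rOut) atTop (𝓝 0) := by
    have := (tendsto_one_div_add_atTop_nhds_zero_nat (𝕜 := ℝ)).const_mul δ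
    simpa [ρ, div_eq_mul_inv] using this
  have hρ' : ∀ n, (ρ n).rOut ≤ 2 * (ρ n).rIn := fun n => by
    change δ / (n + 1) ≤ 2 * (δ / (n + 1) / 2)
    linarith
  have hρδ : ∀ n, (ρ n).rOut ≤ δ := fun n => by
    change δ / (n + 1) ≤ δ
    exact div_le_self hδ.le (by linarith [n.cast_nonneg (α := ℝ)])
  have hder : ∀ n, ∀ x ∈ tsupport φ, fderiv ℝ (moll (ρ n) U) x e = moll (ρ n) G x := by
    intro n x hx
    rw [moll_fderiv _ iU, moll_apply]
    set ψ : EuclideanSpace ℝ (Fin N) → ℝ := fun y => (ρ n).normed volume (x - y) with hψ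
    have hsupp : tsupport ψ ⊆ Metric.closedBall x δ := by
      refine closure_minimal ?_ Metric.isClosed_closedBall
      intro y hy
      have : x - y ∈ Function.support ((ρ n).normed volume) := hy
      rw [(ρ n).support_normed_eq, mem_ball_zero_iff] at this
      rw [Metric.mem_closedBall, dist_comm, dist_eq_norm]
      exact this.le.trans (hρδ n)
    have hψt : IsTestFun N Ω ψ := by
      refine ⟨?_, ?_, ?_⟩
      · exact (ρ n).contDiff_normed.comp (contDiff_const.sub contDiff_id)
      · exact (isCompact_closedBall x δ).of_isClosed_subset (isClosed_tsupport _) hsupp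
      · exact hsupp.trans ((Metric.closedBall_subset_cthickening hx δ).trans hδΩ)
    have h := hw ψ hψt i
    have e1 : ∀ k : EuclideanSpace ℝ (Fin N) → ℝ, ∀ v : EuclideanSpace ℝ (Fin N) → ℝ,
        ∫ t, Ω.indicator v t * k t = ∫ t in Ω, v t * k t := by
      intro k v
      rw [← integral_indicator hΩ.measurableSet]
      congr 1; funext t
      by_cases ht : t ∈ Ω <;> simp [ht]
    rw [hU, e1, h, neg_neg, ← e1]
    congr 1; funext t; rw [mul_comm]
  have hUn : ∀ n, ContDiff ℝ 1 (moll (ρ n) U) := fun n => moll_contDiff _ iU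
  have hFUd : ∀ n x, HasFDerivAt (fun x => F (moll (ρ n) U x))
      (F' (moll (ρ n) U x) • fderiv ℝ (moll (ρ n) U) x) x := fun n x =>
    (hF _).comp_hasFDerivAt x ((hUn n).differentiable (by norm_num) x).hasFDerivAt
  have hFUc : ∀ n, Continuous fun x => F (moll (ρ n) U x) := fun n => Fc.comp (hUn n).continuous
  have hF'Uc : ∀ n, Continuous fun x => F' (moll (ρ n) U x) := fun n => hF'.comp (hUn n).continuous
  have hn : ∀ n, ∫ x, F (moll (ρ n) U x) * fderiv ℝ φ x e
      = - ∫ x, F' (moll (ρ n) U x) * moll (ρ n) G x * φ x := by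
    intro n
    have hfd : ∀ x, fderiv ℝ (fun x => F (moll (ρ n) U x)) x e
        = F' (moll (ρ n) U x) * fderiv ℝ (moll (ρ n) U) x e := by
      intro x; rw [(hFUd n x).fderiv]; simp
    have hdc : Continuous fun x => fderiv ℝ (moll (ρ n) U) x e :=
      ((hUn n).continuous_fderiv (by norm_num)).clm_apply continuous_const
    rw [integral_mul_fderiv_eq_neg_fderiv_mul_of_integrable]
    · congr 2; funext x
      rw [hfd]
      by_cases hx : x ∈ tsupport φ
      · rw [hder n x hx]
      · rw [image_eq_zero_of_notMem_tsupport hx]; simp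
    · simp_rw [hfd]
      exact (((hF'Uc n).mul hdc).mul hφ1.continuous).integrable_of_hasCompactSupport
        hφc.mul_left
    · exact ((hFUc n).mul hφd).integrable_of_hasCompactSupport hφdc.mul_left
    · exact ((hFUc n).mul hφ1.continuous).integrable_of_hasCompactSupport hφc.mul_left
    · exact fun x _ => (hFUd n x).differentiableAt
    · exact fun x _ => hφ1.differentiable (by norm_num) x
  have hUlim := moll_tendsto hρ hρ' iU
  have hGL := moll_tendsto_L1 hρ hρ' iG
  obtain ⟨C, hC⟩ := hφc.exists_bound_of_continuous hφ1.continuous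
  have L1 : Tendsto (fun n => ∫ x, F (moll (ρ n) U x) * fderiv ℝ φ x e) atTop
      (𝓝 (∫ x, F (U x) * fderiv ℝ φ x e)) := by
    refine tendsto_integral_of_dominated_convergence (fun x => M * ‖fderiv ℝ φ x e‖)
      (fun n => ((hFUc n).mul hφd).aestronglyMeasurable)
      ((hφd.integrable_of_hasCompactSupport hφdc).norm.const_mul M) ?_ ?_
    · intro n; filter_upwards with x
      rw [norm_mul]
      exact mul_le_mul_of_nonneg_right (hM _) (norm_nonneg _)
    · filter_upwards [hUlim] with x hx
      exact ((Fc.tendsto _).comp hx).mul tendsto_const_nhds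
  have L2 : Tendsto (fun n => ∫ x, F' (moll (ρ n) U x) * G x * φ x) atTop
      (𝓝 (∫ x, F' (U x) * G x * φ x)) := by
    refine tendsto_integral_of_dominated_convergence (fun x => C * ‖G x‖)
      (fun n => ((hF'Uc n).aestronglyMeasurable.mul iG.aestronglyMeasurable).mul
        hφ1.continuous.aestronglyMeasurable)
      (iG.norm.const_mul C) ?_ ?_
    · intro n; filter_upwards with x
      rw [norm_mul, norm_mul, mul_comm C]
      refine mul_le_mul ?_ (hC x) (norm_nonneg _) (norm_nonneg _)
      exact mul_le_of_le_one_left (norm_nonneg _) (hM' _)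
    · filter_upwards [hUlim] with x hx
      exact (((hF'.tendsto _).comp hx).mul tendsto_const_nhds).mul tendsto_const_nhds
  have hI : ∀ n, ∀ k : EuclideanSpace ℝ (Fin N) → ℝ, Integrable k →
      Integrable fun x => F' (moll (ρ n) U x) * k x * φ x := by
    intro n k hk
    refine (hk.norm.const_mul C).mono' (((hF'Uc n).aestronglyMeasurable.mul
      hk.aestronglyMeasurable).mul hφ1.continuous.aestronglyMeasurable) ?_
    filter_upwards with x
    rw [norm_mul, norm_mul, mul_comm C]
    refine mul_le_mul ?_ (hC x) (norm_nonneg _) (norm_nonneg _)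
    exact mul_le_of_le_one_left (norm_nonneg _) (hM' _)
  have L3 : Tendsto (fun n => (∫ x, F' (moll (ρ n) U x) * moll (ρ n) G x * φ x)
      - ∫ x, F' (moll (ρ n) U x) * G x * φ x) atTop (𝓝 0) := by
    have hb := hGL.const_mul C
    rw [mul_zero] at hb
    refine squeeze_zero_norm (fun n => ?_) hb
    have iGn := moll_integrable (ρ n) iG
    rw [← integral_sub (hI n _ iGn) (hI n _ iG), ← integral_const_mul]
    refine norm_integral_le_of_norm_le ((iGn.sub iG).abs.const_mul C) ?_
    filter_upwards with x
    have : F' (moll (ρ n) U x) * moll (ρ n) G x * φ x - F' (moll (ρ n) U x) * G x * φ x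
      = F' (moll (ρ n) U x) * (moll (ρ n) G x - G x) * φ x := by ring
    rw [this, norm_mul, norm_mul, mul_comm C]
    refine mul_le_mul ?_ (hC x) (norm_nonneg _) (abs_nonneg _)
    exact mul_le_of_le_one_left (norm_nonneg _) (hM' _)
  have L4 := (L3.add L2).neg
  simp only [sub_add_cancel, zero_add] at L4
  simp_rw [hn] at L1
  exact tendsto_nhds_unique L1 L4

theorem level_grad (N : ℕ) (Ω : Set (EuclideanSpace ℝ (Fin N))) (hΩ : IsOpen Ω)
    (u : EuclideanSpace ℝ (Fin N) → ℝ)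
    (g : EuclideanSpace ℝ (Fin N) → EuclideanSpace ℝ (Fin N))
    (hu : IsWeakGradient N Ω u g) (c : ℝ) (i : Fin N) :
    ∀ᵐ x, x ∈ Ω → u x = c → g x i = 0 := by
  classical
  set U := Ω.indicator u with hU
  set G := Ω.indicator (fun x => g x i) with hG
  have iU : Integrable U := (hu.1).integrable_indicator hΩ.measurableSet
  have iG : Integrable G := by
    refine IntegrableOn.integrable_indicator ?_ hΩ.measurableSet
    exact (EuclideanSpace.proj (𝕜 := ℝ) i).integrable_comp hu.2.1
  let F' : ℕ → ℝ → ℝ := fun k t => 1 / (1 + ((k + 1 : ℝ) * (t - c)) ^ 2)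
  let F : ℕ → ℝ → ℝ := fun k t => Real.arctan ((k + 1 : ℝ) * (t - c)) / (k + 1)
  have hF : ∀ k t, HasDerivAt (F k) (F' k t) t := by
    intro k t
    have h1 : HasDerivAt (fun t : ℝ => (k + 1 : ℝ) * (t - c)) (k + 1 : ℝ) t := by
      simpa using ((hasDerivAt_id t).sub_const c).const_mul (k + 1 : ℝ)
    have h2 := h1.arctan.div_const (k + 1 : ℝ)
    refine h2.congr_deriv ?_
    have : (k + 1 : ℝ) ≠ 0 := by positivity
    simp only [F']
    field_simp
  have hF'c : ∀ k, Continuous (F' k) := by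
    intro k
    refine continuous_const.div (by fun_prop) fun t => ?_
    positivity
  have hM : ∀ k t, |F k t| ≤ (Real.pi / 2) / (k + 1) := by
    intro k t
    simp only [F]
    rw [abs_div, abs_of_pos (by positivity : (0:ℝ) < k + 1)]
    gcongr
    exact abs_le.2 ⟨(Real.neg_pi_div_two_lt_arctan _).le, (Real.arctan_lt_pi_div_two _).le⟩
  have hM' : ∀ k t, |F' k t| ≤ 1 := by
    intro k t
    simp only [F']
    rw [abs_of_pos (by positivity)]
    exact div_le_one_of_le₀ (by nlinarith [sq_nonneg ((k + 1 : ℝ) * (t - c))]) (by positivity)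
  have hlim : ∀ t, Tendsto (fun k => F' k t) atTop (𝓝 (if t = c then 1 else 0)) := by
    intro t
    split_ifs with h
    · simp [F', h]
    · have ht : t - c ≠ 0 := sub_ne_zero.2 h
      have a1 : Tendsto (fun k : ℕ => (k + 1 : ℝ)) atTop atTop :=
        tendsto_atTop_add_const_right _ _ tendsto_natCast_atTop_atTop
      have a2 : Tendsto (fun k : ℕ => 1 + (t - c) ^ 2 * ((k + 1 : ℝ)) ^ 2) atTop atTop :=
        tendsto_atTop_add_const_left _ _
          (((tendsto_pow_atTop two_ne_zero).comp a1).const_mul_atTop (by positivity))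
      have a3 := a2.inv_tendsto_atTop
      refine a3.congr fun k => ?_
      simp only [F', Pi.inv_apply]
      rw [one_div, mul_pow, mul_comm]
  have hmeas : ∀ k, AEStronglyMeasurable (fun x => F' k (U x) * G x) := fun k =>
    ((hF'c k).comp_aestronglyMeasurable iU.aestronglyMeasurable).mul iG.aestronglyMeasurable
  have hae : ∀ x, Tendsto (fun k => F' k (U x) * G x) atTop
      (𝓝 ((if U x = c then 1 else 0) * G x)) := fun x => (hlim _).mul tendsto_const_nhds
  set H : EuclideanSpace ℝ (Fin N) → ℝ := fun x => (if U x = c then 1 else 0) * G x with hH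
  have iH : Integrable H := by
    refine iG.norm.mono' (aestronglyMeasurable_of_tendsto_ae atTop hmeas
      (Eventually.of_forall hae)) ?_
    filter_upwards with x
    simp only [hH]
    split_ifs <;> simp
  have key : ∀ᵐ x, x ∈ Ω → H x = 0 := by
    refine hΩ.ae_eq_zero_of_integral_contDiff_smul_eq_zero 
      (iH.locallyIntegrable.locallyIntegrableOn Ω) ?_
    intro φ hφ hφc hφΩ
    have hch := fun k => chain_rule N Ω hΩ u g hu (F k) (F' k) (hF k) (hF'c k) (hM k) (hM' k) φ
      ⟨hφ, hφc, hφΩ⟩ i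
    have hφ1 : ContDiff ℝ 1 φ := hφ.of_le (by exact_mod_cast le_top)
    have hφd : Continuous fun x => fderiv ℝ φ x (EuclideanSpace.single i 1) :=
      (hφ1.continuous_fderiv (by norm_num)).clm_apply continuous_const
    have hφdi := hφd.integrable_of_hasCompactSupport (μ := volume)
      (hφc.fderiv_apply ℝ (EuclideanSpace.single i 1))
    obtain ⟨C, hC⟩ := hφc.exists_bound_of_continuous hφ1.continuous
    have T1 : Tendsto (fun k => ∫ x, F k (U x) * fderiv ℝ φ x (EuclideanSpace.single i 1)) atTop
        (𝓝 0) := by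
      have a : Tendsto (fun k : ℕ => (Real.pi / 2) / (k + 1 : ℝ) *
          ∫ x, ‖fderiv ℝ φ x (EuclideanSpace.single i 1)‖) atTop (𝓝 0) := by
        have := ((tendsto_one_div_add_atTop_nhds_zero_nat (𝕜 := ℝ)).const_mul
          (Real.pi / 2)).mul_const (∫ x, ‖fderiv ℝ φ x (EuclideanSpace.single i 1)‖)
        simpa [div_eq_mul_inv] using this
      refine squeeze_zero_norm (fun k => ?_) a
      rw [← integral_const_mul]
      refine norm_integral_le_of_norm_le (hφdi.norm.const_mul _) ?_
      filter_upwards with x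
      rw [norm_mul]
      exact mul_le_mul_of_nonneg_right (hM _ _) (norm_nonneg _)
    have T2 : Tendsto (fun k => ∫ x, F' k (U x) * G x * φ x) atTop (𝓝 (∫ x, H x * φ x)) := by
      refine tendsto_integral_of_dominated_convergence (fun x => C * ‖G x‖)
        (fun k => (hmeas k).mul hφ1.continuous.aestronglyMeasurable)
        (iG.norm.const_mul C) ?_ ?_
      · intro n; filter_upwards with x
        rw [norm_mul, norm_mul, mul_comm C]
        refine mul_le_mul ?_ (hC x) (norm_nonneg _) (norm_nonneg _)
        exact mul_le_of_le_one_left (norm_nonneg _) (hM' _ _)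
      · filter_upwards with x
        exact (hae x).mul tendsto_const_nhds
    have := tendsto_nhds_unique (T1.congr hch) T2.neg
    simp_rw [smul_eq_mul, mul_comm (φ _)]
    linarith
  filter_upwards [key] with x hx hxΩ hxc
  have := hx hxΩ
  simpa [hH, hU, hG, hxΩ, hxc] using this

/-- If `u ∈ L¹(Ω)` has weak gradient `g ∈ L¹(Ω; ℝ^N)` with `g ≠ 0` a.e. in `Ω`, then every
level set `{x ∈ Ω : u x = c}` has Lebesgue measure zero. -/
theorem level_set_null_of_weakGradient_ne_zero (N : ℕ) (hN : 1 ≤ N)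
    (Ω : Set (EuclideanSpace ℝ (Fin N))) (hΩ : IsOpen Ω)
    (u : EuclideanSpace ℝ (Fin N) → ℝ)
    (g : EuclideanSpace ℝ (Fin N) → EuclideanSpace ℝ (Fin N))
    (hu : IsWeakGradient N Ω u g)
    (hg : ∀ᵐ x ∂(volume.restrict Ω), g x ≠ 0) :
    ∀ c : ℝ, volume {x ∈ Ω | u x = c} = 0 := by
  intro c
  have h1 : ∀ᵐ x, ∀ i, x ∈ Ω → u x = c → g x i = 0 :=
    ae_all_iff.2 fun i => level_grad N Ω hΩ u g hu c i
  rw [ae_restrict_iff' hΩ.measurableSet] at hg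
  have h2 : ∀ᵐ x, ¬ (x ∈ Ω ∧ u x = c) := by
    filter_upwards [h1, hg] with x hx hgx hc
    refine hgx hc.1 ?_
    ext i
    exact hx i hc.1 hc.2
  have h3 := ae_iff.1 h2
  simpa using h3
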